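/- An n×n max-plus matrix A is invertible (i.e., there exists B with A⊙B = B⊙A = I, the max-plus identity matrix) if and only if there is a permutation σ of {1,...,n} and real (finite) scalars α_1,...,α_n such that A_{ij} = α_i when j = σ(i) and A_{ij} = -∞ otherwise. -/

import Mathlib

namespace MaxPlus

/-- Max-plus (tropical) matrix product over `EReal` (`⊥ = -∞` is the max-plus zero,
`+` is the max-plus multiplication, `⊔`/`⨆` is the max-plus addition). -/
noncomputable def mmul {n : ℕ} (A B : Matrix (Fin n) (Fin n) EReal) : Matrix (Fin n) (Fin n) EReal :=
  fun i j => ⨆ k, A i k + B k j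

/-- The max-plus identity matrix. -/
noncomputable def mId (n : ℕ) : Matrix (Fin n) (Fin n) EReal := fun i j => if i = j then 0 else ⊥

/-- Max-plus matrix powers. -/
noncomputable def mpow {n : ℕ} (A : Matrix (Fin n) (Fin n) EReal) : ℕ → Matrix (Fin n) (Fin n) EReal
  | 0 => mId n
  | m + 1 => mmul (mpow A m) A

/-- The max-plus Kleene star `A* = I ⊕ A ⊕ A² ⊕ ⋯` (entrywise supremum of all powers). -/
noncomputable def mstar {n : ℕ} (A : Matrix (Fin n) (Fin n) EReal) : Matrix (Fin n) (Fin n) EReal :=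
  fun i j => ⨆ m, mpow A m i j

/-- Weight of the cycle determined by the list `l = [i₁,…,i_k]`,
namely `A i₁ i₂ + ⋯ + A i_k i₁`. -/
noncomputable def cycleWeight {n : ℕ} (A : Matrix (Fin n) (Fin n) EReal) (l : List (Fin n)) : EReal :=
  ((l.zip (l.rotate 1)).map fun p => A p.1 p.2).sum

/-- A nonempty list of pairwise distinct indices, representing an elementary cycle. -/
def IsCycle {n : ℕ} (l : List (Fin n)) : Prop := l ≠ [] ∧ l.Nodup

/-- All elementary cycles have nonpositive weight, i.e. the maximal cycle mean `λ(A) ≤ 0`. -/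
def CycleBound {n : ℕ} (A : Matrix (Fin n) (Fin n) EReal) : Prop :=
  ∀ l : List (Fin n), IsCycle l → cycleWeight A l ≤ 0

/-- A definite matrix: maximal cycle mean `0` and zero (max-plus unit) diagonal.
(The diagonal entries give cycles of weight `0`, so `λ(A) = 0` is equivalent to
`CycleBound A` here.) -/
def Definite {n : ℕ} (A : Matrix (Fin n) (Fin n) EReal) : Prop :=
  CycleBound A ∧ ∀ i, A i i = 0

/-- Max-plus action of a matrix on a vector: `(A ⊙ x)_i = max_j (A_{ij} + x_j)`. -/
noncomputable def mapVec {n : ℕ} (A : Matrix (Fin n) (Fin n) EReal) (x : Fin n → EReal) :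
    Fin n → EReal :=
  fun i => ⨆ j, A i j + x j

/-- The max-plus eigenspace of `A` for the eigenvalue `0`. -/
def eig {n : ℕ} (A : Matrix (Fin n) (Fin n) EReal) : Set (Fin n → EReal) :=
  {x | mapVec A x = x}

/-- The max-plus column span of a matrix. -/
def mspan {n : ℕ} (A : Matrix (Fin n) (Fin n) EReal) : Set (Fin n → EReal) :=
  {y | ∃ α : Fin n → EReal, y = fun i => ⨆ j, α j + A i j}

theorem bot_of_mmul_eq_mId {n : ℕ} {A B : Matrix (Fin n) (Fin n) EReal} (h : mmul A B = mId n)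
    {i j : Fin n} (hij : i ≠ j) (k : Fin n) : A i k = ⊥ ∨ B k j = ⊥ := by
  have h₁ : (⨆ k, A i k + B k j) = ⊥ := by
    simpa [mmul, mId, hij] using congrFun (congrFun h i) j
  exact EReal.add_eq_bot_iff.mp (iSup_eq_bot.mp h₁ k)

theorem exists_finite_of_mmul_eq_mId {n : ℕ} {A B : Matrix (Fin n) (Fin n) EReal}
    (h : mmul A B = mId n) (i : Fin n) : ∃ k, ∃ a : ℝ, A i k = a ∧ B k i ≠ ⊥ := by
  have : Nonempty (Fin n) := ⟨i⟩
  have h₁ : (⨆ k, A i k + B k i) = 0 := by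
    simpa [mmul, mId] using congrFun (congrFun h i) i
  obtain ⟨k, hk⟩ := exists_eq_ciSup_of_finite (f := fun k => A i k + B k i)
  have h₂ : A i k + B k i = 0 := hk.trans h₁
  have hB : B k i ≠ ⊥ := fun hb => by simp [hb] at h₂
  have hA : A i k ≠ ⊥ := fun ha => by simp [ha] at h₂
  have hA' : A i k ≠ ⊤ := fun ha => by simp [ha, EReal.top_add_of_ne_bot hB] at h₂
  exact ⟨k, (A i k).toReal, (EReal.coe_toReal hA' hA).symm, hB⟩

/-- An `n × n` max-plus matrix is invertible iff it is a "permutation matrix with finite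
scalings": `A_{ij} = α_i` when `j = σ i` and `A_{ij} = -∞` otherwise. -/
theorem invertible_iff_scaled_permutation {n : ℕ} (A : Matrix (Fin n) (Fin n) EReal) :
    (∃ B : Matrix (Fin n) (Fin n) EReal, mmul A B = mId n ∧ mmul B A = mId n) ↔
      ∃ (σ : Equiv.Perm (Fin n)) (α : Fin n → ℝ),
        ∀ i j, A i j = if j = σ i then (α i : EReal) else ⊥ := by
  constructor
  · rintro ⟨B, hAB, hBA⟩
    choose f α hα hB using exists_finite_of_mmul_eq_mId hAB
    have hf : Function.Injective f := by
      intro i j hij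
      by_contra hne
      rcases bot_of_mmul_eq_mId hAB hne (f i) with h | h
      · simp [hα] at h
      · exact hB j (hij ▸ h)
    refine ⟨Equiv.ofBijective f (Finite.injective_iff_bijective.mp hf), α, fun i j => ?_⟩
    rw [Equiv.ofBijective_apply]
    split_ifs with hj
    · rw [hj, hα]
    · exact (bot_of_mmul_eq_mId hBA (Ne.symm hj) i).resolve_left (hB i)
  · rintro ⟨σ, α, hA⟩
    have hcancel (x : ℝ) : (x : EReal) + -(x : EReal) = 0 := by
      rw [← EReal.coe_neg, ← EReal.coe_add, add_neg_cancel, EReal.coe_zero]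
    refine ⟨fun k j => if k = σ j then -(α j : EReal) else ⊥, ?_, ?_⟩
    · ext i j
      simp only [mmul, mId, hA]
      split_ifs with hij
      · subst hij
        refine le_antisymm (iSup_le fun k => ?_) (le_iSup_of_le (σ i) ?_)
        · split_ifs <;> simp [hcancel]
        · simp [hcancel]
      · refine iSup_eq_bot.mpr fun k => EReal.add_eq_bot_iff.mpr ?_
        by_cases hk : k = σ i
        · subst hk
          simp [hij]
        · simp [hk]
    · ext k j
      simp only [mmul, mId, hA]
      split_ifs with hkj
      · subst hkj
        refine le_antisymm (iSup_le fun i => ?_) (le_iSup_of_le (σ.symm k) ?_)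
        · split_ifs <;> simp [hcancel, add_comm]
        · simp [hcancel, add_comm]
      · refine iSup_eq_bot.mpr fun i => EReal.add_eq_bot_iff.mpr ?_
        by_cases hk : k = σ i
        · subst hk
          simp [Ne.symm hkj]
        · simp [hk]

end MaxPlus
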